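/- Let d : ℕ, s > 0, and 0 < t < 2s. For every p ∈ MvPolynomial (Fin d) ℝ, the Segal–Bargmann isometry holds: ∫∫ ‖MvPolynomial.eval (fun i => (x i : ℂ) + (y i) * Complex.I) (MvPolynomial.map (algebraMap ℝ ℂ) (e^{tΔ/2} p))‖² dγ_{s - t/2}^d(x) dγ_{t/2}^d(y) = ∫ (MvPolynomial.eval x p)² dγ_s^d(x). That is, the analytic continuation of the heat operator applied to p is isometric from L²(γ_s^d) into L² of the Gaussian measure on ℂ^d whose real parts have variance s - t/2 and whose imaginary parts have variance t/2. -/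

import Mathlib

open MeasureTheory ProbabilityTheory MvPolynomial

/-- The product Gaussian measure `γ_r^d` of variance `r` on `Fin d → ℝ`. -/
noncomputable def gaussianPi (d : ℕ) (r : ℝ) : Measure (Fin d → ℝ) :=
  Measure.pi (fun _ : Fin d => gaussianReal 0 r.toNNReal)

/-- The Laplacian `Δ p = ∑ i, ∂²p/∂x_i²` on polynomials in `d` variables. -/
noncomputable def mvLaplacian {d : ℕ} (p : MvPolynomial (Fin d) ℝ) :
    MvPolynomial (Fin d) ℝ :=
  ∑ i : Fin d, pderiv i (pderiv i p)

/-- The heat operator `e^{tΔ/2} p = ∑_{k ≤ totalDegree p} ((t/2)^k / k!) • Δ^k p`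
(a terminating series, since `Δ` is locally nilpotent). -/
noncomputable def heatOp {d : ℕ} (t : ℝ) (p : MvPolynomial (Fin d) ℝ) :
    MvPolynomial (Fin d) ℝ :=
  ∑ k ∈ Finset.range (p.totalDegree + 1),
    ((t / 2) ^ k / (k.factorial : ℝ)) • (mvLaplacian (d := d))^[k] p

section Heat

variable {σ : Type*}

lemma MvPolynomial.pderiv_pderiv_comm (i j : σ) (p : MvPolynomial σ ℝ) :
    pderiv i (pderiv j p) = pderiv j (pderiv i p) := by
  have h : ⁅(pderiv i : Derivation ℝ (MvPolynomial σ ℝ) _), (pderiv j : Derivation ℝ _ _)⁆ = 0 := by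
    classical
    refine MvPolynomial.derivation_ext fun k => ?_
    simp [Derivation.commutator_apply, pderiv_X, Pi.single_apply, apply_ite]
  simpa [Derivation.commutator_apply, sub_eq_zero] using DFunLike.congr_fun h p

lemma Finsupp.degree_tsub_single_one_add_one {a : σ →₀ ℕ} {i : σ} (h : a i ≠ 0) :
    (a - Finsupp.single i 1).degree + 1 = a.degree := by
  conv_rhs => rw [← tsub_add_cancel_of_le
    (Finsupp.single_le_iff.2 (Nat.one_le_iff_ne_zero.2 h))]
  rw [map_add, Finsupp.degree_single]

lemma MvPolynomial.totalDegree_pderiv_le (i : σ) (p : MvPolynomial σ ℝ) :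
    (pderiv i p).totalDegree ≤ p.totalDegree - 1 := by
  classical
  conv_lhs => rw [p.as_sum, map_sum]
  refine totalDegree_finsetSum_le fun a ha => ?_
  rw [pderiv_monomial]
  by_cases h : a i = 0
  · simp [h]
  refine (totalDegree_monomial_le _ _).trans ?_
  have h1 : a.degree ≤ p.totalDegree := le_totalDegree ha
  have h2 := Finsupp.degree_tsub_single_one_add_one h
  change (a - Finsupp.single i 1).degree ≤ _
  omega

variable {d : ℕ}

/-- The Laplacian as a linear map. -/
noncomputable def mvLaplacianLin (d : ℕ) :
    MvPolynomial (Fin d) ℝ →ₗ[ℝ] MvPolynomial (Fin d) ℝ :=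
  ∑ i : Fin d, (pderiv i).toLinearMap ∘ₗ (pderiv i).toLinearMap

lemma mvLaplacianLin_apply (p : MvPolynomial (Fin d) ℝ) :
    mvLaplacianLin d p = mvLaplacian p := by
  simp [mvLaplacianLin, mvLaplacian]

lemma iterate_mvLaplacian (k : ℕ) (p : MvPolynomial (Fin d) ℝ) :
    (mvLaplacian (d := d))^[k] p = (mvLaplacianLin d ^ k) p := by
  rw [Module.End.pow_apply, ← funext mvLaplacianLin_apply]

lemma mvLaplacianLin_pow_eq_zero {k : ℕ} {p : MvPolynomial (Fin d) ℝ}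
    (h : p.totalDegree < k) : (mvLaplacianLin d ^ k) p = 0 := by
  induction k generalizing p with
  | zero => simp at h
  | succ k ih =>
    rw [pow_succ, Module.End.mul_apply, mvLaplacianLin_apply]
    rcases Nat.eq_zero_or_pos p.totalDegree with h0 | h0
    · rw [totalDegree_eq_zero_iff_eq_C.1 h0]
      simp [mvLaplacian]
    · refine ih (lt_of_le_of_lt (totalDegree_finsetSum_le fun i _ => ?_)
        (show p.totalDegree - 1 < k by omega))
      have h1 := totalDegree_pderiv_le i (pderiv i p)
      have h2 := totalDegree_pderiv_le i p
      omega

lemma heatOp_eq_sum (t : ℝ) {N : ℕ} {p : MvPolynomial (Fin d) ℝ} (h : p.totalDegree < N) :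
    heatOp t p = ∑ k ∈ Finset.range N,
      ((t / 2) ^ k / (k.factorial : ℝ)) • (mvLaplacianLin d ^ k) p := by
  simp_rw [heatOp, iterate_mvLaplacian]
  refine Finset.sum_subset (Finset.range_subset_range.2 h) fun k _ hk => ?_
  rw [mvLaplacianLin_pow_eq_zero (by simpa using hk), smul_zero]

/-- The heat operator as a linear map. -/
noncomputable def heatLin (d : ℕ) (t : ℝ) :
    MvPolynomial (Fin d) ℝ →ₗ[ℝ] MvPolynomial (Fin d) ℝ where
  toFun := heatOp t
  map_add' p q := by
    have h := totalDegree_add p q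
    have h' : max p.totalDegree q.totalDegree < max p.totalDegree q.totalDegree + 1 := by omega
    rw [heatOp_eq_sum t (h.trans_lt h'), heatOp_eq_sum t ((le_max_left _ _).trans_lt h'),
      heatOp_eq_sum t ((le_max_right _ _).trans_lt h')]
    simp [Finset.sum_add_distrib]
  map_smul' c p := by
    rw [heatOp_eq_sum t (Nat.lt_succ_of_le (totalDegree_smul_le c p)),
      heatOp_eq_sum t (Nat.lt_succ_self p.totalDegree)]
    simp [Finset.smul_sum, smul_comm c]

lemma heatLin_apply (t : ℝ) (p : MvPolynomial (Fin d) ℝ) : heatLin d t p = heatOp t p := rfl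

lemma heatLin_one (t : ℝ) : heatLin d t 1 = 1 := by
  rw [heatLin_apply, heatOp_eq_sum t (N := 1) (by simp)]
  simp

lemma mvLaplacianLin_pow_pderiv (k : ℕ) (i : Fin d) (p : MvPolynomial (Fin d) ℝ) :
    (mvLaplacianLin d ^ k) (pderiv i p) = pderiv i ((mvLaplacianLin d ^ k) p) := by
  induction k with
  | zero => simp
  | succ k ih =>
    simp_rw [pow_succ', Module.End.mul_apply, ih, mvLaplacianLin_apply, mvLaplacian, map_sum,
      pderiv_pderiv_comm _ i]

lemma heatLin_pderiv (t : ℝ) (i : Fin d) (p : MvPolynomial (Fin d) ℝ) :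
    heatLin d t (pderiv i p) = pderiv i (heatLin d t p) := by
  rw [heatLin_apply, heatLin_apply, heatOp_eq_sum t (Nat.lt_succ_self p.totalDegree),
    heatOp_eq_sum t (N := p.totalDegree.succ)
      (((totalDegree_pderiv_le i p).trans (Nat.sub_le _ _)).trans_lt (Nat.lt_succ_self _))]
  simp [mvLaplacianLin_pow_pderiv]

lemma mvLaplacian_X_mul (i : Fin d) (p : MvPolynomial (Fin d) ℝ) :
    mvLaplacian (X i * p) = X i * mvLaplacian p + 2 * pderiv i p := by
  classical
  have h (j : Fin d) : pderiv j (pderiv j (X i * p)) =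
      X i * pderiv j (pderiv j p) + if j = i then 2 * pderiv i p else 0 := by
    rcases eq_or_ne j i with rfl | hj
    · simp only [pderiv_mul, pderiv_X_self, map_add, pderiv_one, if_true]
      ring
    · simp [pderiv_X_of_ne hj.symm, hj]
  simp only [mvLaplacian, h, Finset.sum_add_distrib, Finset.mul_sum, Finset.sum_ite_eq',
    Finset.mem_univ, if_true]

lemma mvLaplacianLin_pow_succ_X_mul (k : ℕ) (i : Fin d) (p : MvPolynomial (Fin d) ℝ) :
    (mvLaplacianLin d ^ (k + 1)) (X i * p) = X i * (mvLaplacianLin d ^ (k + 1)) p +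
      (2 * (k + 1 : ℝ)) • (mvLaplacianLin d ^ k) (pderiv i p) := by
  induction k with
  | zero =>
    simp [mvLaplacianLin_apply, mvLaplacian_X_mul, two_mul, two_smul]
  | succ k ih =>
    rw [pow_succ', Module.End.mul_apply, ih, map_add, mvLaplacianLin_apply (X i * _),
      mvLaplacian_X_mul, ← mvLaplacianLin_apply, map_smul, ← Module.End.mul_apply,
      ← Module.End.mul_apply, ← pow_succ', ← pow_succ', ← mvLaplacianLin_pow_pderiv]
    simp only [smul_eq_C_mul, map_mul, map_add, map_ofNat, map_one, Nat.cast_add, Nat.cast_one]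
    ring

lemma heatLin_X_mul (t : ℝ) (i : Fin d) (p : MvPolynomial (Fin d) ℝ) :
    heatLin d t (X i * p) = X i * heatLin d t p + t • heatLin d t (pderiv i p) := by
  have h1 := totalDegree_mul (X i) p
  rw [totalDegree_X] at h1
  have h2 := totalDegree_pderiv_le i p
  rw [heatLin_apply, heatLin_apply, heatLin_apply,
    heatOp_eq_sum t (N := p.totalDegree + 1 + 1) (by omega),
    heatOp_eq_sum t (N := p.totalDegree + 1 + 1) (p := p) (by omega),
    heatOp_eq_sum t (N := p.totalDegree + 1) (by omega),
    Finset.sum_range_succ' _ (p.totalDegree + 1), Finset.sum_range_succ' _ (p.totalDegree + 1),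
    mul_add, Finset.mul_sum, Finset.smul_sum,
    add_right_comm, ← Finset.sum_add_distrib]
  congr 1
  · refine Finset.sum_congr rfl fun k _ => ?_
    rw [mvLaplacianLin_pow_succ_X_mul, smul_add, mul_smul_comm, smul_smul, smul_smul]
    congr 2
    rw [Nat.factorial_succ]
    push_cast
    field_simp
    ring
  · simp

end Heat

section Gaussian

open scoped NNReal

lemma integrable_pow_gaussianReal (v : ℝ≥0) (n : ℕ) :
    Integrable (fun x : ℝ => x ^ n) (gaussianReal 0 v) := by
  have h := (memLp_id_gaussianReal' (μ := 0) (v := v) n (by simp)).integrable_norm_pow'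
  refine (integrable_norm_iff (by fun_prop)).1 ?_
  simpa using h

lemma hasDerivAt_gaussianPDFReal {v : ℝ≥0} (hv : v ≠ 0) (x : ℝ) :
    HasDerivAt (gaussianPDFReal 0 v) (-(x / v) * gaussianPDFReal 0 v x) x := by
  have hv' : (v : ℝ) ≠ 0 := by exact_mod_cast hv
  unfold gaussianPDFReal
  have h : HasDerivAt (fun x : ℝ => -(x - 0) ^ 2 / (2 * v)) (-(x / v)) x := by
    simp_rw [sub_zero]
    refine ((hasDerivAt_pow 2 x).neg.div_const (2 * (v : ℝ))).congr_deriv ?_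
    simp
    field_simp
  exact (h.exp.const_mul _).congr_deriv (by ring)

lemma integral_mul_pow_gaussianReal (v : ℝ≥0) (n : ℕ) :
    ∫ x : ℝ, x ^ (n + 1) ∂gaussianReal 0 v = v * (n * ∫ x : ℝ, x ^ (n - 1) ∂gaussianReal 0 v) := by
  rcases eq_or_ne v 0 with rfl | hv
  · simp [gaussianReal_zero_var]
  have hv' : (v : ℝ) ≠ 0 := by exact_mod_cast hv
  have hint (m : ℕ) : Integrable (fun x : ℝ => x ^ m * gaussianPDFReal 0 v x) := by
    have h := integrable_pow_gaussianReal v m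
    rw [gaussianReal_of_var_ne_zero _ hv, integrable_withDensity_iff_integrable_smul'
      (measurable_gaussianPDF _ _) (.of_forall fun _ => gaussianPDF_lt_top)] at h
    simpa [toReal_gaussianPDF, mul_comm] using h
  have key := integral_mul_deriv_eq_deriv_mul_of_integrable
    (u := fun x : ℝ => x ^ n) (u' := fun x => n * x ^ (n - 1))
    (v := gaussianPDFReal 0 v) (v' := fun x => -(x / v) * gaussianPDFReal 0 v x)
    (fun x _ => hasDerivAt_pow n x) (fun x _ => hasDerivAt_gaussianPDFReal hv x)
    (((hint (n + 1)).const_mul (-(v : ℝ)⁻¹)).congr (.of_forall fun x => by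
      simp only [Pi.mul_apply]; ring))
    (((hint (n - 1)).const_mul (n : ℝ)).congr (.of_forall fun x => by
      simp only [Pi.mul_apply]; ring))
    (hint n)
  rw [integral_gaussianReal_eq_integral_smul hv, integral_gaussianReal_eq_integral_smul hv]
  have e1 : ∫ x : ℝ, x ^ n * (-(x / v) * gaussianPDFReal 0 v x) =
      -(v : ℝ)⁻¹ * ∫ x, gaussianPDFReal 0 v x • x ^ (n + 1) := by
    rw [← integral_const_mul]
    refine integral_congr_ae (.of_forall fun x => ?_)
    simp only [smul_eq_mul]; ring
  have e2 : ∫ x : ℝ, n * x ^ (n - 1) * gaussianPDFReal 0 v x =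
      n * ∫ x, gaussianPDFReal 0 v x • x ^ (n - 1) := by
    rw [← integral_const_mul]
    refine integral_congr_ae (.of_forall fun x => ?_)
    simp only [smul_eq_mul]; ring
  rw [e1, e2] at key
  field_simp at key
  linarith

variable {ι : Type*} [Fintype ι]

lemma eval_ofReal_monomial (x : ι → ℝ) (a : ι →₀ ℕ) (c : ℂ) :
    eval (fun i => (x i : ℂ)) (monomial a c) = c * ∏ i, (x i : ℂ) ^ a i := by
  rw [eval_monomial, Finsupp.prod_fintype _ _ (by simp)]

lemma integrable_eval_gaussian (v : ι → ℝ≥0) (P : MvPolynomial ι ℂ) :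
    Integrable (fun x : ι → ℝ => eval (fun i => (x i : ℂ)) P)
      (Measure.pi fun i => gaussianReal 0 (v i)) := by
  induction P using MvPolynomial.induction_on' with
  | monomial a c =>
    simp_rw [eval_ofReal_monomial]
    refine Integrable.const_mul (Integrable.fintype_prod
      (f := fun i (y : ℝ) => (y : ℂ) ^ a i) fun i => ?_) c
    simpa using (integrable_pow_gaussianReal (v i) (a i)).ofReal (𝕜 := ℂ)
  | add p q hp hq => exact (hp.add hq).congr (.of_forall fun x => by simp)

/-- The expectation of a complex polynomial in independent centered real Gaussian variables of
variances `v i`. -/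
noncomputable def gaussianExpect (v : ι → ℝ≥0) : MvPolynomial ι ℂ →ₗ[ℂ] ℂ where
  toFun P := ∫ x : ι → ℝ, eval (fun i => (x i : ℂ)) P ∂Measure.pi fun i => gaussianReal 0 (v i)
  map_add' P Q := by
    simp_rw [map_add]
    exact integral_add (integrable_eval_gaussian v P) (integrable_eval_gaussian v Q)
  map_smul' c P := by
    simp_rw [smul_eval, integral_const_mul]
    rfl

lemma gaussianExpect_apply (v : ι → ℝ≥0) (P : MvPolynomial ι ℂ) : gaussianExpect v P =
    ∫ x : ι → ℝ, eval (fun i => (x i : ℂ)) P ∂Measure.pi fun i => gaussianReal 0 (v i) := rfl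

lemma gaussianExpect_one (v : ι → ℝ≥0) : gaussianExpect v 1 = 1 := by
  simp [gaussianExpect_apply]

lemma gaussianExpect_C_mul (v : ι → ℝ≥0) (c : ℂ) (P : MvPolynomial ι ℂ) :
    gaussianExpect v (C c * P) = c * gaussianExpect v P := by
  rw [← smul_eq_C_mul, map_smul, smul_eq_mul]

lemma gaussianExpect_monomial (v : ι → ℝ≥0) (a : ι →₀ ℕ) (c : ℂ) :
    gaussianExpect v (monomial a c) =
      c * ∏ i, ((∫ x : ℝ, x ^ a i ∂gaussianReal 0 (v i) : ℝ) : ℂ) := by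
  simp_rw [gaussianExpect_apply, eval_ofReal_monomial, integral_const_mul]
  rw [integral_fintype_prod_eq_prod (fun i (y : ℝ) => (y : ℂ) ^ a i)]
  simp_rw [← Complex.ofReal_pow, integral_complex_ofReal]

/-- Gaussian integration by parts for polynomials. -/
lemma gaussianExpect_X_mul (v : ι → ℝ≥0) (j : ι) (P : MvPolynomial ι ℂ) :
    gaussianExpect v (X j * P) = (v j : ℝ) * gaussianExpect v (pderiv j P) := by
  classical
  induction P using MvPolynomial.induction_on' with
  | add p q hp hq => rw [mul_add, map_add, hp, hq, map_add, map_add, mul_add]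
  | monomial a c =>
    rw [X, monomial_mul, pderiv_monomial, gaussianExpect_monomial, gaussianExpect_monomial,
      ← Finset.mul_prod_erase _ _ (Finset.mem_univ j),
      ← Finset.mul_prod_erase _ _ (Finset.mem_univ j)]
    have h1 : ∏ i ∈ Finset.univ.erase j,
        ((∫ x : ℝ, x ^ ((Finsupp.single j 1 + a : ι →₀ ℕ) i) ∂gaussianReal 0 (v i) : ℝ) : ℂ) =
        ∏ i ∈ Finset.univ.erase j,
          ((∫ x : ℝ, x ^ ((a - Finsupp.single j 1 : ι →₀ ℕ) i) ∂gaussianReal 0 (v i) : ℝ) : ℂ) := by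
      refine Finset.prod_congr rfl fun i hi => ?_
      simp [Finsupp.single_eq_of_ne (Finset.ne_of_mem_erase hi)]
    rw [h1]
    simp only [Finsupp.add_apply, Finsupp.single_eq_same, add_comm 1 (a j),
      integral_mul_pow_gaussianReal, Finsupp.tsub_apply]
    push_cast
    ring

end Gaussian

section SegalBargmann

variable {d : ℕ}

/-- A bilinear form satisfying the Gaussian integration-by-parts recursion in both arguments is
determined by its value at `(1, 1)`. -/
lemma bilinear_eq_zero_of_recursion {σ : Type*} (s : ℂ)
    (D : MvPolynomial σ ℝ →ₗ[ℝ] MvPolynomial σ ℝ →ₗ[ℝ] ℂ)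
    (hl : ∀ i p q, D (X i * p) q = s * (D (pderiv i p) q + D p (pderiv i q)))
    (hr : ∀ i p q, D p (X i * q) = s * (D (pderiv i p) q + D p (pderiv i q)))
    (h1 : D 1 1 = 0) : D = 0 := by
  classical
  have X_mul_sub {a : σ →₀ ℕ} {i : σ} (h : a i ≠ 0) :
      monomial a (1 : ℝ) = X i * monomial (a - Finsupp.single i 1) 1 := by
    rw [X, monomial_mul, one_mul, add_comm,
      tsub_add_cancel_of_le (Finsupp.single_le_iff.2 (Nat.one_le_iff_ne_zero.2 h))]
  have key (n : ℕ) : ∀ a b : σ →₀ ℕ, a.degree + b.degree = n → ∀ c e : ℝ,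
      D (monomial a c) (monomial b e) = 0 := by
    induction n using Nat.strong_induction_on with
    | _ n ih =>
      intro a b hab
      have hd (i : σ) (a' b' : σ →₀ ℕ) (h : a'.degree + b'.degree < n) :
          D (pderiv i (monomial a' 1)) (monomial b' 1)
            + D (monomial a' 1) (pderiv i (monomial b' 1)) = 0 := by
        have hle (x : σ →₀ ℕ) : (x - Finsupp.single i 1).degree ≤ x.degree :=
          Finsupp.degree_mono tsub_le_self
        rw [pderiv_monomial, pderiv_monomial,
          ih _ ((Nat.add_le_add_right (hle a') _).trans_lt h) _ _ rfl,
          ih _ ((Nat.add_le_add_left (hle b') _).trans_lt h) _ _ rfl, add_zero]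
      suffices h : D (monomial a 1) (monomial b 1) = 0 by
        intro c e
        have hc (x : σ →₀ ℕ) (r : ℝ) : monomial x r = r • monomial x 1 := by
          rw [smul_monomial, smul_eq_mul, mul_one]
        rw [hc a, hc b, map_smul, map_smul, LinearMap.smul_apply, h, smul_zero, smul_zero]
      by_cases ha : a = 0
      · by_cases hb : b = 0
        · simpa [ha, hb] using h1
        · obtain ⟨i, hi⟩ := Finsupp.ne_iff.1 hb
          have := Finsupp.degree_tsub_single_one_add_one hi
          rw [X_mul_sub hi, hr, hd _ _ _ (by omega), mul_zero]
      · obtain ⟨i, hi⟩ := Finsupp.ne_iff.1 ha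
        have := Finsupp.degree_tsub_single_one_add_one hi
        rw [X_mul_sub hi, hl, hd _ _ _ (by omega), mul_zero]
  refine MvPolynomial.linearMap_ext fun a => LinearMap.ext fun c => ?_
  refine MvPolynomial.linearMap_ext fun b => LinearMap.ext fun e => ?_
  exact key _ a b rfl c e

/-- Substitution of `x + c y` into a real polynomial. -/
noncomputable def substLine (d : ℕ) (c : ℂ) :
    MvPolynomial (Fin d) ℝ →ₐ[ℝ] MvPolynomial (Fin d ⊕ Fin d) ℂ :=
  aeval fun i => X (Sum.inl i) + C c * X (Sum.inr i)

lemma substLine_X (c : ℂ) (i : Fin d) :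
    substLine d c (X i) = X (Sum.inl i) + C c * X (Sum.inr i) := by
  simp [substLine]

lemma pderiv_inl_substLine (c : ℂ) (i : Fin d) (p : MvPolynomial (Fin d) ℝ) :
    pderiv (Sum.inl i) (substLine d c p) = substLine d c (pderiv i p) := by
  classical
  induction p using MvPolynomial.induction_on with
  | C a => simp [substLine, MvPolynomial.algebraMap_apply]
  | add p q hp hq => simp [hp, hq]
  | mul_X p j hp =>
    rw [map_mul, pderiv_mul, pderiv_mul, hp, map_add, map_mul, map_mul, substLine_X, map_add,
      pderiv_C_mul, pderiv_X, pderiv_X, pderiv_X]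
    rcases eq_or_ne i j with rfl | h
    · simp
    · simp [h.symm]

lemma pderiv_inr_substLine (c : ℂ) (i : Fin d) (p : MvPolynomial (Fin d) ℝ) :
    pderiv (Sum.inr i) (substLine d c p) = C c * substLine d c (pderiv i p) := by
  classical
  induction p using MvPolynomial.induction_on with
  | C a => simp [substLine, MvPolynomial.algebraMap_apply]
  | add p q hp hq => simp [hp, hq, mul_add]
  | mul_X p j hp =>
    rw [map_mul, pderiv_mul, pderiv_mul, hp, map_add, map_mul, map_mul, substLine_X, map_add,
      pderiv_C_mul, pderiv_X, pderiv_X, pderiv_X]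
    rcases eq_or_ne i j with rfl | h
    · simp
      ring
    · simp [h.symm]
      ring

lemma eval_substLine (c : ℂ) (w : Fin d ⊕ Fin d → ℂ) (p : MvPolynomial (Fin d) ℝ) :
    eval w (substLine d c p) = eval (fun i => w (Sum.inl i) + c * w (Sum.inr i))
      (map (algebraMap ℝ ℂ) p) := by
  induction p using MvPolynomial.induction_on with
  | C a => simp [substLine, MvPolynomial.algebraMap_apply]
  | add p q hp hq => simp [hp, hq]
  | mul_X p j hp => simp [hp, substLine_X]

lemma gaussianExpect_heat_X_mul {v : Fin d ⊕ Fin d → NNReal} {s t : ℝ} {i : Fin d}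
    (hx : (v (Sum.inl i) : ℝ) = s - t / 2) (hy : (v (Sum.inr i) : ℝ) = t / 2)
    {c : ℂ} (hc : c * c = -1) (p q : MvPolynomial (Fin d) ℝ) :
    gaussianExpect v (substLine d c (heatLin d t (X i * p)) * substLine d (-c) (heatLin d t q)) =
      s * (gaussianExpect v
          (substLine d c (heatLin d t (pderiv i p)) * substLine d (-c) (heatLin d t q)) +
        gaussianExpect v
          (substLine d c (heatLin d t p) * substLine d (-c) (heatLin d t (pderiv i q)))) := by
  simp only [heatLin_X_mul, heatLin_pderiv, map_add, map_mul, map_smul, substLine_X]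
  rw [← algebraMap_smul ℂ t, smul_eq_C_mul]
  have h1 := gaussianExpect_X_mul v (Sum.inl i)
    (substLine d c (heatLin d t p) * substLine d (-c) (heatLin d t q))
  have h2 := gaussianExpect_X_mul v (Sum.inr i)
    (substLine d c (heatLin d t p) * substLine d (-c) (heatLin d t q))
  simp only [pderiv_mul, pderiv_inl_substLine, pderiv_inr_substLine, map_neg] at h1 h2
  generalize substLine d c (heatLin d t p) = P at *
  generalize substLine d (-c) (heatLin d t q) = Q at *
  generalize substLine d c (pderiv i (heatLin d t p)) = P' at *
  generalize substLine d (-c) (pderiv i (heatLin d t q)) = Q' at *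
  rw [show C c * P' * Q + P * (-C c * Q') = C c * (P' * Q) - C c * (P * Q') by ring,
    map_sub, gaussianExpect_C_mul, gaussianExpect_C_mul, hy] at h2
  rw [map_add, hx] at h1
  rw [show ((X (Sum.inl i) + C c * X (Sum.inr i)) * P + C (algebraMap ℝ ℂ t) * P') * Q =
      X (Sum.inl i) * (P * Q) + C c * (X (Sum.inr i) * (P * Q))
        + C (algebraMap ℝ ℂ t) * (P' * Q) by ring,
    map_add, map_add, gaussianExpect_C_mul, gaussianExpect_C_mul, h1, h2]
  simp only [Complex.coe_algebraMap]
  push_cast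
  linear_combination ((t : ℂ) / 2 * (gaussianExpect v (P' * Q) - gaussianExpect v (P * Q'))) * hc

/-- The polarized Segal–Bargmann isometry. -/
lemma gaussianExpect_heat_mul {v : Fin d ⊕ Fin d → NNReal} {w : Fin d → NNReal} {s t : ℝ}
    (hx : ∀ i, (v (Sum.inl i) : ℝ) = s - t / 2) (hy : ∀ i, (v (Sum.inr i) : ℝ) = t / 2)
    (hw : ∀ i, (w i : ℝ) = s) (p q : MvPolynomial (Fin d) ℝ) :
    gaussianExpect v (substLine d Complex.I (heatLin d t p) *
        substLine d (-Complex.I) (heatLin d t q)) =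
      gaussianExpect w (map (algebraMap ℝ ℂ) p * map (algebraMap ℝ ℂ) q) := by
  let F : MvPolynomial (Fin d) ℝ →ₗ[ℝ] MvPolynomial (Fin d) ℝ →ₗ[ℝ] ℂ :=
    ((LinearMap.mul ℝ _).compl₁₂ ((substLine d Complex.I).toLinearMap ∘ₗ heatLin d t)
      ((substLine d (-Complex.I)).toLinearMap ∘ₗ heatLin d t)).compr₂
        ((gaussianExpect v).restrictScalars ℝ)
  let G : MvPolynomial (Fin d) ℝ →ₗ[ℝ] MvPolynomial (Fin d) ℝ →ₗ[ℝ] ℂ :=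
    ((LinearMap.mul ℝ _).compl₁₂ (mapAlgHom (Algebra.ofId ℝ ℂ)).toLinearMap
      (mapAlgHom (Algebra.ofId ℝ ℂ)).toLinearMap).compr₂ ((gaussianExpect w).restrictScalars ℝ)
  have hF (p q) : F p q = gaussianExpect v (substLine d Complex.I (heatLin d t p) *
    substLine d (-Complex.I) (heatLin d t q)) := rfl
  have hG (p q) : G p q =
    gaussianExpect w (map (algebraMap ℝ ℂ) p * map (algebraMap ℝ ℂ) q) := rfl
  have hG' (i p q) : gaussianExpect w (X i * (map (algebraMap ℝ ℂ) p * map (algebraMap ℝ ℂ) q)) =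
      s * (G (pderiv i p) q + G p (pderiv i q)) := by
    rw [gaussianExpect_X_mul, hw, pderiv_mul, map_add, pderiv_map, pderiv_map]
    rfl
  have h0 : F - G = 0 := by
    refine bilinear_eq_zero_of_recursion s (F - G) (fun i p q => ?_) (fun i p q => ?_) ?_
    · simp only [LinearMap.sub_apply]
      rw [hG (X i * p), map_mul (map _), map_X, mul_assoc, hG', hF (X i * p),
        gaussianExpect_heat_X_mul (hx i) (hy i) Complex.I_mul_I, ← hF, ← hF]
      ring
    · simp only [LinearMap.sub_apply]
      have h := gaussianExpect_heat_X_mul (hx i) (hy i) (c := -Complex.I) (by simp) q p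
      simp only [neg_neg, mul_comm (substLine d (-Complex.I) _), ← hF] at h
      rw [hG p (X i * q), map_mul (map _), map_X, mul_left_comm, hG', h]
      ring
    · simp [hF, hG, heatLin_one, gaussianExpect_one]
  have := LinearMap.congr_fun₂ h0 p q
  rwa [LinearMap.sub_apply, LinearMap.sub_apply, LinearMap.zero_apply, LinearMap.zero_apply,
    sub_eq_zero, hF, hG] at this

lemma eval_map_conj (z : Fin d → ℂ) (p : MvPolynomial (Fin d) ℝ) :
    starRingEnd ℂ (eval z (map (algebraMap ℝ ℂ) p)) =
      eval (fun i => starRingEnd ℂ (z i)) (map (algebraMap ℝ ℂ) p) := by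
  induction p using MvPolynomial.induction_on with
  | C a => simp
  | add p q hp hq => simp only [map_add, hp, hq]
  | mul_X p j hp => simp only [map_mul, map_X, eval_X, hp]

lemma eval_map_ofReal (x : Fin d → ℝ) (p : MvPolynomial (Fin d) ℝ) :
    eval (fun i => (x i : ℂ)) (map (algebraMap ℝ ℂ) p) = (eval x p : ℝ) := by
  induction p using MvPolynomial.induction_on with
  | C a => simp
  | add p q hp hq => simp only [map_add, hp, hq, Complex.ofReal_add]
  | mul_X p j hp => simp only [map_mul, map_X, eval_X, hp, Complex.ofReal_mul]

lemma integral_gaussianPi_gaussianPi (a b : ℝ) (P : MvPolynomial (Fin d ⊕ Fin d) ℂ) :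
    ∫ y, ∫ x, eval (Sum.elim (fun i => (x i : ℂ)) fun i => (y i : ℂ)) P
        ∂gaussianPi d a ∂gaussianPi d b =
      gaussianExpect (Sum.elim (fun _ => a.toNNReal) fun _ => b.toNNReal) P := by
  have hmp := measurePreserving_sumPiEquivProdPi_symm (X := fun _ : Fin d ⊕ Fin d => ℝ)
    (fun j => gaussianReal 0 (Sum.elim (fun _ => a.toNNReal) (fun _ => b.toNNReal) j))
  have hev (z : (Fin d → ℝ) × (Fin d → ℝ)) :
      (fun j => (((MeasurableEquiv.sumPiEquivProdPi fun _ : Fin d ⊕ Fin d => ℝ).symm z j : ℝ) : ℂ))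
        = Sum.elim (fun i => (z.1 i : ℂ)) fun i => (z.2 i : ℂ) := by
    ext (j | j) <;> rfl
  have hint := (hmp.integrable_comp_emb (MeasurableEquiv.measurableEmbedding _)).2
    (integrable_eval_gaussian (Sum.elim (fun _ => a.toNNReal) fun _ => b.toNNReal) P)
  rw [gaussianExpect_apply, ← hmp.integral_comp']
  simp only [Function.comp_def, hev] at hint ⊢
  exact (integral_prod_symm _ hint).symm

end SegalBargmann

/-- The Segal–Bargmann isometry on polynomials: the analytic continuation of
`e^{tΔ/2} p` to `ℂ^d` has the same `L²` norm with respect to the Gaussian measure whose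
real parts have variance `s - t/2` and imaginary parts have variance `t/2` as `p` has in
`L²(γ_s^d)`. -/
theorem segalBargmann_isometry
    (d : ℕ) (s t : ℝ) (hs : 0 < s) (ht : 0 < t) (hts : t < 2 * s)
    (p : MvPolynomial (Fin d) ℝ) :
    ∫ y, ∫ x,
        ‖MvPolynomial.eval (fun i => (x i : ℂ) + (y i : ℂ) * Complex.I)
            (MvPolynomial.map (algebraMap ℝ ℂ) (heatOp t p))‖ ^ 2
          ∂(gaussianPi d (s - t / 2)) ∂(gaussianPi d (t / 2)) =
      ∫ x, (MvPolynomial.eval x p) ^ 2 ∂(gaussianPi d s) := by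
  have key := gaussianExpect_heat_mul (d := d)
    (v := Sum.elim (fun _ => (s - t / 2).toNNReal) fun _ => (t / 2).toNNReal)
    (w := fun _ => s.toNNReal) (s := s) (t := t)
    (fun _ => Real.coe_toNNReal _ (by linarith)) (fun _ => Real.coe_toNNReal _ (by linarith))
    (fun _ => Real.coe_toNNReal _ hs.le) p p
  rw [← integral_gaussianPi_gaussianPi, gaussianExpect_apply] at key
  have hl (x y : Fin d → ℝ) : eval (Sum.elim (fun i => (x i : ℂ)) fun i => (y i : ℂ))
      (substLine d Complex.I (heatLin d t p) * substLine d (-Complex.I) (heatLin d t p)) =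
      ((‖eval (fun i => (x i : ℂ) + (y i : ℂ) * Complex.I)
        (map (algebraMap ℝ ℂ) (heatOp t p))‖ ^ 2 : ℝ) : ℂ) := by
    rw [Complex.ofReal_pow, ← Complex.mul_conj', eval_map_conj, map_mul, eval_substLine,
      eval_substLine, heatLin_apply]
    simp [mul_comm Complex.I]
  simp_rw [hl, integral_complex_ofReal, map_mul, eval_map_ofReal, ← Complex.ofReal_mul,
    integral_complex_ofReal, Complex.ofReal_inj, ← sq] at key
  exact key
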